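/- For every natural number k, pp(k) ≡ Σ (−1)^n (2n+1) p(m) (mod 5), where the sum is over all pairs of natural numbers (n, m) with 5m + n(n+1)/2 = k. -/

import Mathlib

/-- A partition, represented as a weakly decreasing list of positive integers. -/
def IsPartition (l : List ℕ) : Prop :=
  l.Pairwise (· ≥ ·) ∧ ∀ x ∈ l, 0 < x

/-- The BG-rank of a partition `λ₁ ≥ λ₂ ≥ …`:  `Σᵢ (−1)^(i+1) (λᵢ mod 2)`
(with 1-based indexing, i.e. the first part contributes with sign `+1`). -/
def bgRank (l : List ℕ) : ℤ :=
  ∑ i ∈ Finset.range l.length, (-1 : ℤ) ^ i * ((l.getD i 0 : ℤ) % 2)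

/-- `p n`, the number of partitions of `n`. -/
noncomputable def partitionCount (n : ℕ) : ℕ :=
  Nat.card {l : List ℕ // IsPartition l ∧ l.sum = n}

/-- `p_j(n)`, the number of partitions of `n` with BG-rank `j`. -/
noncomputable def pj (j : ℤ) (n : ℕ) : ℕ :=
  Nat.card {l : List ℕ // IsPartition l ∧ l.sum = n ∧ bgRank l = j}

/-- `pp n`, the number of ordered pairs of partitions of total size `n`. -/
noncomputable def pp (n : ℕ) : ℕ :=
  ∑ k ∈ Finset.range (n + 1), partitionCount k * partitionCount (n - k)

instance fact5 : Fact (Nat.Prime 5) := ⟨by norm_num⟩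

open PowerSeries in
/-- The finite q-factorial over the field with five elements. -/
noncomputable def qf (N : ℕ) : PowerSeries (ZMod 5) := ∏ i ∈ Finset.range N, (1 - X ^ (i + 1))

/-- Shifted inverse q-factorials. -/
noncomputable def rr : ℕ → PowerSeries (ZMod 5)
  | 0 => 0
  | k + 1 => (qf k)⁻¹

/-- Partition generating function. -/
noncomputable def PP : PowerSeries (ZMod 5) := PowerSeries.mk fun n => (partitionCount n : ZMod 5)

open PowerSeries

theorem qf_succ (N : ℕ) : qf (N + 1) = qf N * (1 - X ^ (N + 1)) := by
  simp [qf, Finset.prod_range_succ]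

theorem qf_const (N : ℕ) : constantCoeff (qf N) = 1 := by
  simp [qf, map_prod]

theorem rr_mul (k : ℕ) : rr (k + 1) * qf k = 1 := by
  simp only [rr]
  exact PowerSeries.inv_mul_cancel _ (by rw [qf_const]; exact one_ne_zero)

theorem rr_rec (k : ℕ) : rr k = (1 - X ^ k) * rr (k + 1) := by
  cases k with
  | zero => simp [rr]
  | succ k =>
    have h1 := rr_mul k
    have h2 := rr_mul (k + 1)
    rw [qf_succ] at h2
    linear_combination (rr (k + 1 + 1) * (1 - X ^ (k + 1))) * h1 - rr (k + 1) * h2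

/-- Triangular numbers. -/
def tri (n : ℕ) : ℕ := n * (n + 1) / 2

theorem tri_succ (n : ℕ) : tri (n + 1) = tri n + n + 1 := by
  have : (n + 1) * (n + 1 + 1) = n * (n + 1) + (n + 1) * 2 := by ring
  rw [tri, tri, this, Nat.add_mul_div_right _ _ (by norm_num)]; ring

theorem le_tri (n : ℕ) : n ≤ tri n := by
  induction n with
  | zero => simp
  | succ n ih => rw [tri_succ]; omega

/-- The summands of the finite Jacobi identity. -/
noncomputable def dd (N n : ℕ) : PowerSeries (ZMod 5) :=
  (-1) ^ n * X ^ tri n * (rr (N + 1 - n) * rr (N + n + 2))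

theorem dd_zero (N n : ℕ) (h : N < n) : dd N n = 0 := by
  have : N + 1 - n = 0 := by omega
  simp [dd, this, rr]

theorem dd_rec (N n : ℕ) : (1 - X ^ (2 * N + 2)) * (1 - X ^ (2 * N + 3)) * dd (N + 1) (n + 1) =
    (1 + (X ^ (N + 1)) ^ 2) * dd N (n + 1) - X ^ (N + 1) * (dd N n + dd N (n + 2)) := by
  rcases lt_or_ge N n with h | h
  · rw [dd_zero _ _ h, dd_zero _ (n + 1) (by omega), dd_zero _ (n + 2) (by omega),
      dd_zero _ (n + 1) (by omega)]
    simp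
  · obtain ⟨m, rfl⟩ := Nat.exists_eq_add_of_le h
    have t1 := tri_succ n
    have t2 := tri_succ (n + 1)
    cases m with
    | zero =>
      rw [dd_zero (n + 0) (n + 1) (by omega), dd_zero _ (n + 2) (by omega)]
      have e1 : n + 0 + 1 + 1 - (n + 1) = 1 := by omega
      have e2 : n + 0 + 1 - n = 1 := by omega
      simp only [dd, e1, e2, t1]
      have h1 := rr_rec (n + 0 + n + 2)
      have h2 := rr_rec (n + 0 + n + 2 + 1)
      have e3 : n + 0 + 1 + (n + 1) + 2 = n + 0 + n + 2 + 1 + 1 := by ring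
      rw [e3, h1, h2]
      ring
    | succ l =>
      have e1 : n + (l + 1) + 1 + 1 - (n + 1) = l + 1 + 1 := by omega
      have e2 : n + (l + 1) + 1 - n = l + 1 + 1 := by omega
      have e3 : n + (l + 1) + 1 - (n + 1) = l + 1 := by omega
      have e4 : n + (l + 1) + 1 - (n + 2) = l := by omega
      have f1 : n + (l + 1) + 1 + (n + 1) + 2 = 2 * n + l + 3 + 1 + 1 := by ring
      have f2 : n + (l + 1) + (n + 1) + 2 = 2 * n + l + 3 + 1 := by ring
      have f3 : n + (l + 1) + n + 2 = 2 * n + l + 3 := by ring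
      have f4 : n + (l + 1) + (n + 2) + 2 = 2 * n + l + 3 + 1 + 1 := by ring
      have t3 : tri (n + 2) = tri n + n + 1 + (n + 1) + 1 := by rw [← t1, ← t2]
      simp only [dd, e1, e2, e3, e4, f1, f2, f3, f4, t1, t3]
      rw [rr_rec l, rr_rec (l + 1), rr_rec (2 * n + l + 3), rr_rec (2 * n + l + 3 + 1)]
      ring

theorem dd_rec_zero (N : ℕ) : (1 - X ^ (2 * N + 2)) * (1 - X ^ (2 * N + 3)) * dd (N + 1) 0 =
    (1 + (X ^ (N + 1)) ^ 2) * dd N 0 - X ^ (N + 1) * (dd N 1 - dd N 0) := by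
  have t1 := tri_succ 0
  have e4 : N + 1 - 1 = N := by omega
  simp only [dd, t1, e4, zero_add, Nat.sub_zero, add_zero]
  rw [rr_rec N, rr_rec (N + 1), rr_rec (N + 2)]
  ring

theorem abel_sum {R : Type*} [CommRing R] (d d' : ℕ → R) (a Q : R)
    (h0 : a * d' 0 = (1 + Q ^ 2) * d 0 - Q * (d 1 - d 0))
    (h1 : ∀ n, a * d' (n + 1) = (1 + Q ^ 2) * d (n + 1) - Q * (d n + d (n + 2))) (M : ℕ) :
    a * ∑ n ∈ Finset.range (M + 1), (2 * (n : R) + 1) * d' n =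
      (1 - Q) ^ 2 * ∑ n ∈ Finset.range (M + 1), (2 * (n : R) + 1) * d n
      - Q * ((2 * (M : R) + 1) * d (M + 1) - (2 * (M : R) + 3) * d M) := by
  induction M with
  | zero => simp; linear_combination h0
  | succ M ih =>
    rw [Finset.sum_range_succ, Finset.sum_range_succ _ (M + 1)]
    push_cast
    linear_combination ih + (2 * (M : R) + 3) * h1 M

theorem jacobi_fin (M N : ℕ) (h : N ≤ M) :
    (∑ n ∈ Finset.range (M + 1), (2 * (n : PowerSeries (ZMod 5)) + 1) * dd N n) * qf (2 * N + 1)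
      = qf N ^ 2 := by
  induction N with
  | zero =>
    rw [Finset.sum_eq_single 0]
    · have h1 := rr_mul 0
      have h2 := rr_mul 1
      have h3 : qf 0 = 1 := by simp [qf]
      simp only [dd, h3, tri] at *
      simp at *
      rw [h1, one_mul, h2]
    · intro b _ hb
      rw [dd_zero _ _ (by omega), mul_zero]
    · simp
  | succ N ih =>
    have ih := ih (by omega)
    have := abel_sum (dd N) (dd (N + 1)) _ (X ^ (N + 1)) (dd_rec_zero N) (dd_rec N) M
    rw [dd_zero N (M + 1) (by omega), dd_zero N M (by omega)] at this
    have e : 2 * (N + 1) + 1 = 2 * N + 1 + 1 + 1 := by ring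
    rw [e, qf_succ, qf_succ, qf_succ N]
    linear_combination qf (2 * N + 1) * this + (1 - X ^ (N + 1)) ^ 2 * ih

theorem pc_eq (n : ℕ) : partitionCount n = Fintype.card (Nat.Partition n) := by
  rw [partitionCount, ← Nat.card_eq_fintype_card]
  refine Nat.card_congr ⟨fun l => ⟨(l.1 : Multiset ℕ), fun {i} hi => l.2.1.2 i (by simpa using hi),
    by simpa using l.2.2⟩, fun p => ⟨p.parts.sort (· ≥ ·), ⟨?_, ?_⟩, ?_⟩, ?_, ?_⟩
  · exact Multiset.pairwise_sort _ _
  · intro x hx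
    exact p.parts_pos (by simpa using hx)
  · have := p.parts_sum
    rw [← Multiset.sort_eq p.parts (· ≥ ·), Multiset.sum_coe] at this
    exact this
  · intro l
    ext1
    change (l.1 : Multiset ℕ).sort (· ≥ ·) = l.1
    refine List.Perm.eq_of_pairwise' (r := (· ≥ ·)) (Multiset.pairwise_sort _ _) l.2.1.1 ?_
    rw [← Multiset.coe_eq_coe, Multiset.sort_eq]
  · intro p
    ext1
    simp

theorem qf_dvd (k N : ℕ) (h : k ≤ N) : (X : PowerSeries (ZMod 5)) ^ (k + 1) ∣ qf N - qf k := by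
  induction N, h using Nat.le_induction with
  | base => simp
  | succ N h ih =>
    have : qf (N + 1) - qf k = (qf N - qf k) - X ^ (N + 1) * qf N := by rw [qf_succ]; ring
    rw [this]
    exact dvd_sub ih (Dvd.dvd.mul_right (pow_dvd_pow _ (by omega)) _)

open PowerSeries.WithPiTopology in
theorem exists_E : ∃ E : PowerSeries (ZMod 5), PP * E = 1 ∧
    ∀ k, (X : PowerSeries (ZMod 5)) ^ (k + 1) ∣ E - qf k := by
  let _ : TopologicalSpace (ZMod 5) := ⊥
  have _ : DiscreteTopology (ZMod 5) := ⟨rfl⟩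
  have hP := Nat.Partition.hasProd_powerSeriesMk_card_restricted (ZMod 5) (fun _ => True)
  have hE := (multipliable_one_sub_X_pow (ZMod 5)).hasProd
  refine ⟨∏' i, (1 - X ^ (i + 1)), ?_, ?_⟩
  · have h := hP.mul hE
    have hPP : PP = PowerSeries.mk
        (fun n ↦ ((Nat.Partition.restricted n (fun _ => True)).card : ZMod 5)) := by
      ext n
      simp [PP, pc_eq, Nat.Partition.restricted]
    rw [hPP]
    refine h.unique ?_
    convert hasProd_one using 2 with i
    simp only [if_true, pow_mul]
    rw [tsum_pow_mul_one_sub_of_constantCoeff_eq_zero (by simp)]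
  · intro k
    have ht := hE.tendsto_prod_nat
    rw [tendsto_iff_coeff_tendsto] at ht
    rw [X_pow_dvd_iff]
    intro m hm
    have := ht m
    rw [nhds_discrete, Filter.tendsto_pure, Filter.eventually_atTop] at this
    obtain ⟨a, ha⟩ := this
    have h1 := ha (max a k) (le_max_left _ _)
    have h2 := X_pow_dvd_iff.1 (qf_dvd k (max a k) (le_max_right _ _)) m hm
    rw [map_sub, ← h1]
    rw [map_sub] at h2
    exact h2

theorem frob (f : PowerSeries (ZMod 5)) (d : ℕ) :
    coeff d (f ^ 5) = if 5 ∣ d then coeff (d / 5) f else 0 := by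
  have h1 : (X : PowerSeries (ZMod 5)) ^ (d + 1) ∣ f - (trunc (d + 1) f : PowerSeries (ZMod 5)) := by
    rw [X_pow_dvd_iff]
    intro m hm
    simp [coeff_trunc, hm]
  have h2 := X_pow_dvd_iff.1 (h1.trans (sub_dvd_pow_sub_pow _ _ 5)) d (by omega)
  rw [map_sub, sub_eq_zero] at h2
  rw [h2, ← Polynomial.coe_pow, ← ZMod.expand_card, Polynomial.coeff_coe,
    Polynomial.coeff_expand (by norm_num)]
  split_ifs with h
  · rw [coeff_trunc, if_pos (by omega)]
  · rfl

theorem main_dvd (k : ℕ) : (X : PowerSeries (ZMod 5)) ^ (k + 1) ∣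
    (∑ n ∈ Finset.range (k + 1), (-1) ^ n * (2 * (n : PowerSeries (ZMod 5)) + 1) * X ^ tri n)
      * PP ^ 5 - PP ^ 2 := by
  obtain ⟨E, hPE, hE⟩ := exists_E
  set I := Ideal.span {(X : PowerSeries (ZMod 5)) ^ (k + 1)} with hI
  set φ := Ideal.Quotient.mk I with hφ
  have key : ∀ a b, (X : PowerSeries (ZMod 5)) ^ (k + 1) ∣ a - b ↔ φ a = φ b := by
    intro a b
    rw [hφ, Ideal.Quotient.eq, hI, Ideal.mem_span_singleton]
  have hX : ∀ n, k < n → φ (X ^ n) = 0 := by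
    intro n hn
    rw [← map_zero φ, ← key, sub_zero]
    exact pow_dvd_pow _ hn
  have hq : ∀ N, k ≤ N → φ (qf N) = φ E := by
    intro N hN
    rw [(key _ _).1 (qf_dvd k N hN), (key _ _).1 (hE k)]
  have hPE' : φ PP * φ E = 1 := by rw [← map_mul, hPE, map_one]
  have hr : ∀ N, k ≤ N → φ (rr (N + 1)) = φ PP := by
    intro N hN
    have := congrArg φ (rr_mul N)
    rw [map_mul, hq N hN, map_one] at this
    linear_combination φ PP * this - φ (rr (N + 1)) * hPE'
  have hJ := congrArg φ (jacobi_fin (2 * k) (2 * k) le_rfl)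
  rw [map_mul, map_pow, hq _ (by omega), hq _ (by omega), map_sum] at hJ
  have hS : ∑ n ∈ Finset.range (2 * k + 1), φ ((2 * (n : PowerSeries (ZMod 5)) + 1) * dd (2 * k) n)
      = φ (∑ n ∈ Finset.range (k + 1), (-1) ^ n * (2 * (n : PowerSeries (ZMod 5)) + 1) * X ^ tri n)
        * φ PP ^ 2 := by
    rw [map_sum, Finset.sum_mul]
    symm
    refine Finset.sum_subset_zero_on_sdiff ?_ ?_ ?_
    · intro x; simp only [Finset.mem_range]; omega
    · intro n hn
      simp only [Finset.mem_sdiff, Finset.mem_range] at hn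
      rw [dd, map_mul, map_mul, map_mul, hX _ (lt_of_lt_of_le (by omega) (le_tri n))]
      simp
    · intro n hn
      simp only [Finset.mem_range] at hn
      have e : 2 * k + 1 - n = 2 * k - n + 1 := by omega
      simp only [dd, e, map_mul]
      rw [hr _ (by omega), hr (2 * k + n + 1) (by omega)]
      ring
  rw [hS] at hJ
  rw [key, map_mul, map_pow, map_pow]
  set J := φ (∑ n ∈ Finset.range (k + 1), (-1) ^ n * (2 * (n : PowerSeries (ZMod 5)) + 1) * X ^ tri n)
  set p := φ PP
  set e := φ E
  have h3 : J * p ^ 3 = 1 := by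
    linear_combination p ^ 2 * hJ + (-J * p ^ 3 + (p * e + 1)) * hPE'
  linear_combination p ^ 2 * h3

theorem pp_coeff (k : ℕ) : coeff k (PP ^ 2) = (pp k : ZMod 5) := by
  rw [sq, coeff_mul, Finset.Nat.sum_antidiagonal_eq_sum_range_succ_mk]
  simp [PP, pp]

theorem pp_cong_sum (k : ℕ) :
    (pp k : ℤ) ≡
      (∑ q ∈ Finset.range (k + 1) ×ˢ Finset.range (k + 1),
        if 5 * q.2 + q.1 * (q.1 + 1) / 2 = k then
          (-1 : ℤ) ^ q.1 * (2 * q.1 + 1) * (partitionCount q.2 : ℤ)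
        else 0) [ZMOD 5] := by
  have h := X_pow_dvd_iff.1 (main_dvd k) k (by omega)
  rw [map_sub, sub_eq_zero, pp_coeff, Finset.sum_mul, map_sum] at h
  refine (ZMod.intCast_eq_intCast_iff _ _ 5).1 ?_
  rw [Int.cast_natCast, ← h, Finset.sum_product]
  push_cast
  refine Finset.sum_congr rfl fun n hn => ?_
  have e : (-1) ^ n * (2 * (n : PowerSeries (ZMod 5)) + 1) * X ^ tri n * PP ^ 5 =
      C ((-1) ^ n * (2 * (n : ZMod 5) + 1)) * (X ^ tri n * PP ^ 5) := by
    simp only [map_mul, map_pow, map_add, map_neg, map_one, map_natCast, map_ofNat]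
    ring
  rw [e, coeff_C_mul, coeff_X_pow_mul', frob]
  change _ = ∑ m ∈ Finset.range (k + 1), if 5 * m + tri n = k then _ else _
  by_cases hd : tri n ≤ k ∧ 5 ∣ k - tri n
  · rw [if_pos hd.1, if_pos hd.2, Finset.sum_eq_single ((k - tri n) / 5)]
    · rw [if_pos (by omega)]
      simp [PP]
    · intro b _ hb
      rw [if_neg (by omega)]
    · intro hb
      simp only [Finset.mem_range] at hb
      omega
  · rw [Finset.sum_eq_zero]
    · by_cases h1 : tri n ≤ k
      · rw [if_pos h1, if_neg (fun h2 => hd ⟨h1, h2⟩), mul_zero]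
      · rw [if_neg h1, mul_zero]
    · intro m _
      rw [if_neg]
      intro hm
      exact hd ⟨by omega, by omega⟩
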